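/- Let S be a finite index set with at least two elements, D̂_k > 0 for each k ∈ S, and B > 0. If an allocation (B_k)_{k∈S} with B_k > 0 and Σ_{k∈S} B_k ≤ B achieves the minimal receiving time, i.e., max_{k∈S} D̂_k / B_k = (Σ_{k∈S} D̂_k) / B, then Σ_{k∈S} B_k = B and the upload times are all equal: D̂_k / B_k = D̂_i / B_i for all k, i ∈ S. -/

import Mathlib

/-- Proposition 1: if an allocation achieves the minimal receiving time, then the whole
bandwidth budget is used and all upload times are equal. -/
theorem stmt_3 {ι : Type*} (S : Finset ι) (hS : S.Nonempty) (hcard : 1 < S.card)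
    (Dh : ι → ℝ) (hDh : ∀ k ∈ S, 0 < Dh k) (B : ℝ) (hB : 0 < B)
    (Bk : ι → ℝ) (hBkpos : ∀ k ∈ S, 0 < Bk k) (hsum : ∑ k ∈ S, Bk k ≤ B)
    (hopt : S.sup' hS (fun k => Dh k / Bk k) = (∑ k ∈ S, Dh k) / B) :
    (∑ k ∈ S, Bk k = B) ∧
      ∀ k ∈ S, ∀ i ∈ S, Dh k / Bk k = Dh i / Bk i := by
  set T := (∑ k ∈ S, Dh k) / B with hT
  have hTpos : 0 < T := div_pos (Finset.sum_pos hDh hS) hB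
  have hTB : ∑ k ∈ S, Dh k = T * B := by rw [hT, div_mul_cancel₀ _ hB.ne']
  have hle : ∀ k ∈ S, Dh k ≤ T * Bk k := fun k hk =>
    (div_le_iff₀ (hBkpos k hk)).1 (hopt ▸ Finset.le_sup' (fun k => Dh k / Bk k) hk)
  have hsum_eq : ∑ k ∈ S, Bk k = B := by
    refine le_antisymm hsum (le_of_mul_le_mul_left ?_ hTpos)
    rw [← hTB, Finset.mul_sum]
    exact Finset.sum_le_sum hle
  have heq : ∀ k ∈ S, Dh k = T * Bk k :=
    (Finset.sum_eq_sum_iff_of_le hle).1 (by rw [hTB, ← Finset.mul_sum, hsum_eq])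
  have htime : ∀ k ∈ S, Dh k / Bk k = T := fun k hk =>
    (div_eq_iff (hBkpos k hk).ne').2 (heq k hk)
  exact ⟨hsum_eq, fun k hk i hi => (htime k hk).trans (htime i hi).symm⟩
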